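/- Every class in 𝒢 is a descendant of a unique motif: for every [v] ∈ 𝒢 there exists exactly one class [w] ∈ 𝒢 such that w is a motif and [v] ∈ 𝒟(w). -/

import Mathlib

open scoped Classical

abbrev SL2Z := Matrix.SpecialLinearGroup (Fin 2) ℤ

def Amat : SL2Z := ⟨!![1, 2; 0, 1], by norm_num [Matrix.det_fin_two_of]⟩
def Bmat : SL2Z := ⟨!![1, 0; -2, 1], by norm_num [Matrix.det_fin_two_of]⟩
def Cmat : SL2Z := (Amat * Bmat)⁻¹

def Gamma : Subgroup SL2Z := Subgroup.closure {Amat, Bmat}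

/-- The real entry `i j` of a matrix in `SL₂(ℤ)`. -/
def entry (g : SL2Z) (i j : Fin 2) : ℝ := ((g : Matrix (Fin 2) (Fin 2) ℤ) i j : ℤ)

/-- The Möbius action of `SL₂(ℤ)` on the circle `ℝ ∪ {∞}`. -/
noncomputable def mobius (g : SL2Z) (p : OnePoint ℝ) : OnePoint ℝ :=
  Option.rec (motive := fun _ => OnePoint ℝ)
    (if entry g 1 0 = 0 then OnePoint.infty
     else OnePoint.some (entry g 0 0 / entry g 1 0))
    (fun x => if entry g 1 0 * x + entry g 1 1 = 0 then OnePoint.infty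
      else OnePoint.some ((entry g 0 0 * x + entry g 0 1) / (entry g 1 0 * x + entry g 1 1)))
    p

/-- The fixed-point set of `g` acting on the circle `ℝ ∪ {∞}`. -/
noncomputable def fixedSet (g : SL2Z) : Set (OnePoint ℝ) := {p | mobius g p = p}

/-- `g` is hyperbolic if `|trace g| > 2`. -/
def Hyperbolic (g : SL2Z) : Prop := 2 < |Matrix.trace (g : Matrix (Fin 2) (Fin 2) ℤ)|

/-- Two two-element subsets of the circle are linked if the two points of `Q` lie in
different connected components of the complement of `P`. -/
def Linked (P Q : Set (OnePoint ℝ)) : Prop :=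
  ∃ q₁ q₂ : OnePoint ℝ, q₁ ≠ q₂ ∧ Q = {q₁, q₂} ∧
    connectedComponentIn Pᶜ q₁ ≠ connectedComponentIn Pᶜ q₂

/-- `h` contributes to the count `s(v)`: `v` and `h * v * h⁻¹` are hyperbolic with
linked fixed-point sets. -/
def GoodConj (v h : Gamma) : Prop :=
  Hyperbolic (v : SL2Z) ∧ Hyperbolic ((h * v * h⁻¹ : Gamma) : SL2Z) ∧
    Linked (fixedSet (v : SL2Z)) (fixedSet ((h * v * h⁻¹ : Gamma) : SL2Z))

/-- Twice `s(v)`: the number of double cosets `⟨v⟩ h ⟨v⟩` in `Γ` such that `v` and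
`h * v * h⁻¹` are hyperbolic with linked fixed-point sets. -/
noncomputable def sTwo (v : Gamma) : ℕ :=
  Nat.card (Quot (fun h h' : {h : Gamma // GoodConj v h} =>
    ∃ m k : ℤ, (h' : Gamma) = v ^ m * (h : Gamma) * v ^ k))

/-- `v` is not a proper power in `Γ`. -/
def NotProperPower (v : Gamma) : Prop := ¬ ∃ u : Gamma, ∃ k : ℕ, 2 ≤ k ∧ v = u ^ k

/-- The self-intersection number `I(g) = n² s(v) + n - 1`, where `g = vⁿ` with `v` not a
proper power and `n ≥ 1`, and `s(v)` is half the number of good double cosets. -/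
noncomputable def Iγ (g : Gamma) : ℤ :=
  if h : ∃ p : Gamma × ℕ, 1 ≤ p.2 ∧ NotProperPower p.1 ∧ g = p.1 ^ p.2 then
    (h.choose.2 : ℤ) ^ 2 * ((sTwo h.choose.1 / 2 : ℕ) : ℤ) + (h.choose.2 : ℤ) - 1
  else 0
/-- The three-letter alphabet `{x, y, z}`. -/
inductive Letter | x | y | z
deriving DecidableEq

/-- The letter of `w` at cyclic position `i`. -/
def cget (w : List Letter) (i : ℕ) : Letter := w.getD (i % w.length) Letter.x

/-- `w` is cyclically reduced: nonempty, and any two cyclically consecutive letters differ. -/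
def CyclRed (w : List Letter) : Prop :=
  w ≠ [] ∧ ∀ i : ℕ, i < w.length → cget w i ≠ cget w (i + 1)

/-- The matrix assigned to a consecutive pair of letters:
`xy ↦ A`, `yx ↦ A⁻¹`, `yz ↦ B`, `zy ↦ B⁻¹`, `zx ↦ C`, `xz ↦ C⁻¹`. -/
def pairM : Letter → Letter → SL2Z
  | .x, .y => Amat
  | .y, .x => Amat⁻¹
  | .y, .z => Bmat
  | .z, .y => Bmat⁻¹
  | .z, .x => Cmat
  | .x, .z => Cmat⁻¹
  | _, _ => 1

/-- `φ(w)`: group the letters of `w` into consecutive pairs and multiply the matrices. -/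
def phiM : List Letter → SL2Z
  | [] => 1
  | [_] => 1
  | a :: b :: t => pairM a b * phiM t

lemma pairM_mem (a b : Letter) : pairM a b ∈ Gamma := by
  have hA : Amat ∈ Gamma := Subgroup.subset_closure (by simp)
  have hB : Bmat ∈ Gamma := Subgroup.subset_closure (by simp)
  have hC : Cmat ∈ Gamma := inv_mem (mul_mem hA hB)
  cases a <;> cases b <;>
    simp only [pairM] <;>
    first
      | exact hA | exact hB | exact hC
      | exact inv_mem hA | exact inv_mem hB | exact inv_mem hC
      | exact one_mem _

lemma phiM_mem : ∀ w : List Letter, phiM w ∈ Gamma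
  | [] => one_mem _
  | [_] => one_mem _
  | _ :: b :: t => mul_mem (pairM_mem _ b) (phiM_mem t)

/-- The self-intersection number of the word `w`. -/
noncomputable def Iw (w : List Letter) : ℤ := Iγ ⟨phiM w, phiM_mem w⟩

/-- The combinatorial length `L(w)` (half the number of letters). -/
def Lw (w : List Letter) : ℤ := (w.length : ℤ) / 2
/-- `w` is primitive: as a cyclic word it is not a `k`-fold concatenation of a
shorter word for any `k ≥ 2`. -/
def Primitive (w : List Letter) : Prop :=
  ¬ ∃ u : List Letter, ∃ k : ℕ, 2 ≤ k ∧ u.length < w.length ∧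
      ∃ j : ℕ, w.rotate j = (List.replicate k u).flatten

/-- `w` represents a class of `𝒢`: primitive, cyclically reduced, of even length at least 4. -/
def InG (w : List Letter) : Prop :=
  CyclRed w ∧ Primitive w ∧ 2 ∣ w.length ∧ 4 ≤ w.length

/-- Words representing classes of `𝒢`. -/
def GWord := {w : List Letter // InG w}

/-- `v` is obtained from `u`, or from its reversal, by a cyclic rotation through an
even number of places. -/
def WordEquiv (u v : List Letter) : Prop :=
  ∃ k : ℕ, 2 ∣ k ∧ (v = u.rotate k ∨ v = u.reverse.rotate k)

def GEquiv (u v : GWord) : Prop := WordEquiv u.1 v.1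

/-- The set `𝒢` of equivalence classes. -/
def GClass := Quot GEquiv

/-- The defect `δ(w) = I(w) - L(w)`. -/
noncomputable def deltaW (w : List Letter) : ℤ := Iw w - Lw w

/-- `N_δ(L)`: the number of classes `[w] ∈ 𝒢` with `L(w) = L` and `δ(w) = δ`. -/
noncomputable def Ncount (d L : ℤ) : ℕ :=
  Nat.card {c : GClass // ∃ w : GWord, Quot.mk GEquiv w = c ∧ Lw w.1 = L ∧ deltaW w.1 = d}
/-- The positions `i, i+1, …, i+len-1` (cyclically) form a run of `w`: a maximal cyclic
interval whose letters lie in a two-element subset of `{x, y, z}`. -/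
def RunAt (w : List Letter) (i len : ℕ) : Prop :=
  i < w.length ∧ 2 ≤ len ∧ len < w.length ∧
  (∃ T : Finset Letter, T.card = 2 ∧ ∀ j, j < len → cget w (i + j) ∈ T) ∧
  ¬ (∃ T : Finset Letter, T.card = 2 ∧ ∀ j, j < len + 1 → cget w (i + j) ∈ T) ∧
  ¬ (∃ T : Finset Letter, T.card = 2 ∧ ∀ j, j < len + 1 → cget w (i + w.length - 1 + j) ∈ T)

/-- The type of the run starting at position `i`: the two-element subset of letters it uses. -/
def runType (w : List Letter) (i : ℕ) : Finset Letter := {cget w i, cget w (i + 1)}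

/-- The expansion `w⁺[r]` of `w` at the run starting at position `i`: repeat the
first two letters of the run. -/
def expandAt (w : List Letter) (i : ℕ) : List Letter :=
  w.take i ++ [cget w i, cget w (i + 1)] ++ w.drop i

/-- The contraction `w⁻[r]` of `w` at the run starting at position `i`: delete the
first two letters of the run. -/
def contractAt (w : List Letter) (i : ℕ) : List Letter :=
  if i + 1 < w.length then w.take i ++ w.drop (i + 2)
  else (w.drop 1).dropLast

/-- The run at `(i, len)` is distinguished: strictly longer than every other run of the
same type. -/
def DistinguishedRun (w : List Letter) (i len : ℕ) : Prop :=
  RunAt w i len ∧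
    ∀ i' len', RunAt w i' len' → runType w i' = runType w i → i' ≠ i → len' < len

/-- The rank `ρ(w)`: the number of distinguished runs of `w`. -/
noncomputable def rank (w : List Letter) : ℕ :=
  Nat.card {p : ℕ × ℕ // DistinguishedRun w p.1 p.2}

/-- The motif condition: every run `r` with `ℓ(r) ≥ 4` admits another run `s` of the same
type with `ℓ(r) ≤ ℓ(s) + 2`. -/
def MotifCond (w : List Letter) : Prop :=
  ∀ i len, RunAt w i len → 4 ≤ len →
    ∃ i' len', RunAt w i' len' ∧ runType w i' = runType w i ∧ i' ≠ i ∧ len ≤ len' + 2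

/-- The binomial coefficient `C(n, k)` with the convention that it vanishes when `n` or `k`
is negative, except `C(-1, -1) = 1`. -/
def binC (n k : ℤ) : ℤ :=
  if n = -1 ∧ k = -1 then 1
  else if 0 ≤ n ∧ 0 ≤ k then (n.toNat.choose k.toNat : ℤ)
  else 0

/-- The word-level descendants of `w`: the smallest collection containing `w` and closed
under expansion at distinguished runs. -/
inductive Desc (w : List Letter) : List Letter → Prop
  | base : Desc w w
  | step (v : List Letter) (i len : ℕ) :
      Desc w v → DistinguishedRun v i len → Desc w (expandAt v i)

/-- A bi-infinite word is reduced if neighbouring letters differ. -/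
def Reduced (f : ℤ → Letter) : Prop := ∀ j, f j ≠ f (j + 1)

/-- Position `j` is a turn if its two neighbours carry different letters. -/
def Turn (f : ℤ → Letter) (j : ℤ) : Prop := f (j - 1) ≠ f (j + 1)

/-- The runs of a reduced bi-infinite word are the intervals between consecutive turns. -/
def IsRun (f : ℤ → Letter) (p q : ℤ) : Prop :=
  p < q ∧ Turn f p ∧ Turn f q ∧ ∀ j, p < j → j < q → ¬ Turn f j

/-- The set of the letters at positions `p` and `p + 1`. -/
def typeAt (f : ℤ → Letter) (p : ℤ) : Finset Letter := {f p, f (p + 1)}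

/-- The run `[p, q]` is longer by more than `c` than any other run (modulo `n`) of its type. -/
def Dominant (c : ℤ) (f : ℤ → Letter) (n p q : ℤ) : Prop :=
  IsRun f p q ∧ ∀ p' q', IsRun f p' q' → typeAt f p' = typeAt f p → ¬ n ∣ p' - p →
    q' - p' + c < q - p

/-- A period of `g` is a period of `f`, read from position `p`, with its first two letters
repeated. -/
structure Insertion (f : ℤ → Letter) (n : ℤ) (g : ℤ → Letter) (p : ℤ) : Prop where
  tail : ∀ j, p ≤ j → j < p + n → g (j + 2) = f j
  fst : g p = f p
  snd : g (p + 1) = f (p + 1)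

/-- Equality of bi-infinite words up to an even shift and a reflection that exchanges the even
and the odd positions. -/
def DihedralEquiv (f g : ℤ → Letter) : Prop :=
  ∃ k : ℤ, (∀ j, g j = f (j + 2 * k)) ∨ (∀ j, g j = f (2 * k + 1 - j))

lemma exists_shift_mem {n : ℤ} (hn : 0 < n) (p j : ℤ) :
    ∃ k : ℤ, p ≤ j + k * n ∧ j + k * n < p + n := by
  refine ⟨-((j - p) / n), ?_⟩
  have h1 := Int.emod_add_mul_ediv (j - p) n
  have h2 := Int.emod_nonneg (j - p) hn.ne'
  have h3 := Int.emod_lt_of_pos (j - p) hn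
  constructor <;> nlinarith

lemma periodic_add_mul {f : ℤ → Letter} {n : ℤ} (hf : f.Periodic n) (k j : ℤ) :
    f (j + k * n) = f j := hf.int_mul k j

lemma periodic_ext {f g : ℤ → Letter} {n : ℤ} (hn : 0 < n) (hf : f.Periodic n)
    (hg : g.Periodic n) (p : ℤ) (h : ∀ j, p ≤ j → j < p + n → f j = g j) : f = g := by
  funext j
  obtain ⟨k, h1, h2⟩ := exists_shift_mem hn p j
  rw [← periodic_add_mul hf k j, ← periodic_add_mul hg k j]
  exact h _ h1 h2

lemma comp_add_eq {f : ℤ → Letter} {n : ℤ} (hf : f.Periodic n) (k : ℤ) :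
    (fun j => f (j + k * n)) = f := funext fun j => periodic_add_mul hf k j

lemma turn_comp_add {f : ℤ → Letter} (k j : ℤ) :
    Turn (fun i => f (i + k)) j ↔ Turn f (j + k) := by
  simp only [Turn]
  rw [show j - 1 + k = j + k - 1 by ring, show j + 1 + k = j + k + 1 by ring]

lemma isRun_comp_add {f : ℤ → Letter} (k p q : ℤ) :
    IsRun (fun i => f (i + k)) p q ↔ IsRun f (p + k) (q + k) := by
  simp only [IsRun, turn_comp_add]
  refine and_congr (by omega) (and_congr Iff.rfl (and_congr Iff.rfl ⟨fun h j h1 h2 => ?_,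
    fun h j h1 h2 => h _ (by omega) (by omega)⟩))
  have := h (j - k) (by omega) (by omega)
  rwa [sub_add_cancel] at this

lemma typeAt_comp_add {f : ℤ → Letter} (k p : ℤ) :
    typeAt (fun i => f (i + k)) p = typeAt f (p + k) := by
  simp only [typeAt]
  rw [show p + 1 + k = p + k + 1 by ring]

lemma dominant_comp_add {f : ℤ → Letter} {c n : ℤ} (k p q : ℤ) :
    Dominant c (fun i => f (i + k)) n p q ↔ Dominant c f n (p + k) (q + k) := by
  simp only [Dominant, isRun_comp_add, typeAt_comp_add]
  refine and_congr Iff.rfl ⟨fun h p' q' h1 h2 h3 => ?_, fun h p' q' h1 h2 h3 => ?_⟩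
  · have := h (p' - k) (q' - k) (by simpa using h1) (by simpa using h2)
      (by rwa [show p' - k - p = p' - (p + k) by ring])
    omega
  · have := h _ _ h1 h2 (by rwa [show p' + k - (p + k) = p' - p by ring])
    omega

lemma isRun_add_period {f : ℤ → Letter} {n : ℤ} (hf : f.Periodic n) (k p q : ℤ) :
    IsRun f (p + k * n) (q + k * n) ↔ IsRun f p q := by
  rw [← isRun_comp_add, comp_add_eq hf]

lemma typeAt_add_period {f : ℤ → Letter} {n : ℤ} (hf : f.Periodic n) (k p : ℤ) :
    typeAt f (p + k * n) = typeAt f p := by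
  rw [← typeAt_comp_add, comp_add_eq hf]

lemma dominant_add_period {f : ℤ → Letter} {c n : ℤ} (hf : f.Periodic n) (k p q : ℤ) :
    Dominant c f n (p + k * n) (q + k * n) ↔ Dominant c f n p q := by
  rw [← dominant_comp_add, comp_add_eq hf]

lemma IsRun.right_unique {f : ℤ → Letter} {p q q' : ℤ} (h : IsRun f p q) (h' : IsRun f p q') :
    q = q' := by
  rcases lt_trichotomy q q' with hlt | rfl | hlt
  · exact absurd h.2.2.1 (h'.2.2.2 _ h.1 hlt)
  · rfl
  · exact absurd h'.2.2.1 (h.2.2.2 _ h'.1 hlt)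

lemma IsRun.apply_add_two {f : ℤ → Letter} {p q j : ℤ} (h : IsRun f p q) (h1 : p ≤ j)
    (h2 : j + 2 ≤ q) : f (j + 2) = f j := by
  have := h.2.2.2 (j + 1) (by omega) (by omega)
  rw [Turn, not_not, add_sub_cancel_right, show j + 1 + 1 = j + 2 by ring] at this
  exact this.symm

lemma IsRun.typeAt_eq {f : ℤ → Letter} {p q : ℤ} (h : IsRun f p q) (m : ℕ) :
    p + m < q → typeAt f (p + m) = typeAt f p := by
  induction m with
  | zero => simp
  | succ m ih =>
    intro hm
    push_cast at hm ⊢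
    rw [← ih (by omega)]
    simp only [typeAt]
    rw [show p + (m + 1 : ℤ) + 1 = p + m + 2 by ring, h.apply_add_two (by omega) (by omega),
      Finset.pair_comm, add_assoc p]

lemma IsRun.typeAt_eq_of_mem {f : ℤ → Letter} {p q j : ℤ} (h : IsRun f p q) (h1 : p ≤ j)
    (h2 : j < q) : typeAt f j = typeAt f p := by
  obtain ⟨m, rfl⟩ : ∃ m : ℕ, j = p + m := ⟨(j - p).toNat, by omega⟩
  exact h.typeAt_eq m h2

lemma IsRun.length_lt {f : ℤ → Letter} {n p q : ℤ} (hn : 1 < n) (hf : f.Periodic n)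
    (hr : Reduced f) (h : IsRun f p q) : q - p + 1 < n := by
  by_contra hlt
  have h1 : f (p + n - 1) ∈ typeAt f (p + n - 2) := by
    rw [typeAt, show p + n - 2 + 1 = p + n - 1 by ring]
    simp
  rw [h.typeAt_eq_of_mem (by omega) (by omega), show p + n - 1 = p - 1 + n by ring, hf,
    typeAt, Finset.mem_insert, Finset.mem_singleton] at h1
  rcases h1 with h1 | h1
  · exact hr (p - 1) (by simpa using h1)
  · exact h.2.1 h1

lemma turn_reflect {f : ℤ → Letter} (k j : ℤ) :
    Turn (fun i => f (k - i)) j ↔ Turn f (k - j) := by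
  simp only [Turn]
  rw [show k - (j - 1) = k - j + 1 by ring, show k - (j + 1) = k - j - 1 by ring, ne_comm]

lemma isRun_reflect {f : ℤ → Letter} (k p q : ℤ) :
    IsRun (fun i => f (k - i)) p q ↔ IsRun f (k - q) (k - p) := by
  simp only [IsRun, turn_reflect]
  constructor
  · rintro ⟨h1, h2, h3, h4⟩
    refine ⟨by omega, h3, h2, fun j h5 h6 => ?_⟩
    have := h4 (k - j) (by omega) (by omega)
    rwa [sub_sub_cancel] at this
  · rintro ⟨h1, h2, h3, h4⟩
    exact ⟨by omega, h3, h2, fun j h5 h6 => h4 _ (by omega) (by omega)⟩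

lemma typeAt_reflect {f : ℤ → Letter} {k p q : ℤ} (h : IsRun f (k - q) (k - p)) :
    typeAt (fun i => f (k - i)) p = typeAt f (k - q) := by
  rw [← h.typeAt_eq_of_mem (j := k - p - 1) (by have := h.1; omega) (by omega)]
  simp only [typeAt]
  rw [Finset.pair_comm, sub_add_cancel, sub_sub]

lemma Dominant.reflect {f : ℤ → Letter} {c n p q : ℤ} (hf : f.Periodic n)
    (h : Dominant c f n p q) (k : ℤ) :
    Dominant c (fun i => f (k - i)) n (k - q) (k - p) := by
  have h0 : IsRun f (k - (k - p)) (k - (k - q)) := by simpa using h.1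
  refine ⟨(isRun_reflect _ _ _).2 h0, fun p' q' h1 h2 h3 => ?_⟩
  rw [isRun_reflect] at h1
  rw [typeAt_reflect h0, typeAt_reflect h1, sub_sub_cancel] at h2
  have := h.2 _ _ h1 h2 fun ⟨m, hm⟩ => h3 ?_
  · omega
  · have h4 := (isRun_add_period hf m p q).2 h.1
    rw [show p + m * n = k - q' by linarith] at h4
    exact ⟨-m, by have := h4.right_unique h1; linarith⟩

section Insertion

variable {f g : ℤ → Letter} {n p : ℤ}

lemma Insertion.apply_add_two (h : Insertion f n g p) (hf : f.Periodic n)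
    (hg : g.Periodic (n + 2)) {j : ℤ} (h1 : p ≤ j) (h2 : j ≤ p + n + 1) : g (j + 2) = f j := by
  rcases lt_or_ge j (p + n) with h3 | h3
  · exact h.tail j h1 h3
  obtain rfl | rfl : j = p + n ∨ j = p + 1 + n := by omega
  · rw [hf, ← h.fst, ← hg p, add_assoc]
  · rw [hf, ← h.snd, ← hg (p + 1), add_assoc]

lemma Insertion.reduced_left (h : Insertion f n g p) (hn : 0 < n) (hf : f.Periodic n)
    (hg : g.Periodic (n + 2)) (hr : Reduced g) : Reduced f := by
  intro j
  obtain ⟨k, h1, h2⟩ := exists_shift_mem hn p j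
  rw [← periodic_add_mul hf k j, ← periodic_add_mul hf k (j + 1), ← h.apply_add_two hf hg h1 (by omega),
    ← h.apply_add_two hf hg (j := j + 1 + k * n) (by omega) (by omega)]
  convert hr _ using 2
  ring

lemma Insertion.reduced_right (h : Insertion f n g p) (hn : 2 ≤ n) (hf : f.Periodic n)
    (hg : g.Periodic (n + 2)) (hr : Reduced f) : Reduced g := by
  intro j
  obtain ⟨k, h1, h2⟩ := exists_shift_mem (show 0 < n + 2 by omega) p j
  rw [← periodic_add_mul hg k j, ← periodic_add_mul hg k (j + 1), add_right_comm]
  generalize j + k * (n + 2) = i at h1 h2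
  obtain rfl | rfl | h3 : i = p ∨ i = p + 1 ∨ p + 2 ≤ i := by omega
  · rw [h.fst, h.snd]
    exact hr _
  · rw [h.snd, show p + 1 + 1 = p + 2 by ring, h.tail p le_rfl (by omega)]
    exact (hr p).symm
  · obtain ⟨i, rfl⟩ : ∃ i', i = i' + 2 := ⟨i - 2, by ring⟩
    rw [add_right_comm, h.apply_add_two hf hg (by omega) (by omega),
      h.apply_add_two hf hg (by omega) (by omega)]
    exact hr _

lemma Insertion.turn_left (h : Insertion f n g p) (hn : 2 ≤ n) (hf : f.Periodic n)
    (hg : g.Periodic (n + 2)) : Turn g p ↔ Turn f p := by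
  rw [Turn, Turn, h.snd, ← hg (p - 1), ← hf (p - 1),
    ← h.tail (p - 1 + n) (by omega) (by omega), ← add_assoc]

lemma Insertion.not_turn (h : Insertion f n g p) (hn : 2 ≤ n) {j : ℤ} (h1 : p < j)
    (h2 : j < p + 3) : ¬ Turn g j := by
  rw [Turn, not_not]
  obtain rfl | rfl : j = p + 1 ∨ j = p + 2 := by omega
  · rw [add_sub_cancel_right, h.fst, show p + 1 + 1 = p + 2 by ring, h.tail p le_rfl (by omega)]
  · rw [show p + 2 - 1 = p + 1 by ring, h.snd, add_right_comm,
      h.tail (p + 1) (by omega) (by omega)]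

lemma Insertion.turn_add_two (h : Insertion f n g p) (hf : f.Periodic n)
    (hg : g.Periodic (n + 2)) {j : ℤ} (h1 : p < j) (h2 : j ≤ p + n) :
    Turn g (j + 2) ↔ Turn f j := by
  rw [Turn, Turn, show j + 2 - 1 = j - 1 + 2 by ring, add_right_comm,
    h.apply_add_two hf hg (by omega) (by omega), h.apply_add_two hf hg (by omega) (by omega)]

lemma IsRun.le_add_period {q p' : ℤ} (hf : f.Periodic n) (ht : Turn f p) (h : IsRun f p' q)
    (hp : p' < p + n) : q ≤ p + n := by
  by_contra hlt
  refine h.2.2.2 (p + n) hp (by omega) ?_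
  rw [← turn_comp_add]
  convert ht using 1
  exact funext hf

lemma Insertion.isRun_self (h : Insertion f n g p) (hn : 2 ≤ n) (hf : f.Periodic n)
    (hg : g.Periodic (n + 2)) {q : ℤ} (hq : p < q) :
    IsRun g p (q + 2) ↔ IsRun f p q := by
  have key : ∀ {q}, p < q → q ≤ p + n → (IsRun g p (q + 2) ↔ IsRun f p q) := by
    intro q hq hqn
    simp only [IsRun, h.turn_left hn hf hg, h.turn_add_two hf hg hq hqn]
    refine and_congr (by omega) (and_congr Iff.rfl (and_congr Iff.rfl ⟨fun H j h1 h2 => ?_,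
      fun H j h1 h2 => ?_⟩))
    · rw [← h.turn_add_two hf hg h1 (by omega)]
      exact H _ (by omega) (by omega)
    · rcases lt_or_ge j (p + 3) with h3 | h3
      · exact h.not_turn hn h1 h3
      · obtain ⟨i, rfl⟩ : ∃ i', j = i' + 2 := ⟨j - 2, by ring⟩
        rw [h.turn_add_two hf hg (by omega) (by omega)]
        exact H _ (by omega) (by omega)
  constructor
  · intro H
    have := H.le_add_period hg H.2.1 (by omega)
    exact (key hq (by omega)).1 H
  · intro H
    have := H.le_add_period hf H.2.1 (by omega)
    exact (key hq (by omega)).2 H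

lemma Insertion.isRun_add_two (h : Insertion f n g p) (hn : 2 ≤ n) (hf : f.Periodic n)
    (hg : g.Periodic (n + 2)) (ht : Turn f p) {p' q' : ℤ} (h1 : p < p') (h2 : p' < p + n) :
    IsRun g (p' + 2) (q' + 2) ↔ IsRun f p' q' := by
  have key : q' ≤ p + n → (IsRun g (p' + 2) (q' + 2) ↔ IsRun f p' q') := by
    intro hqn
    by_cases hq : p' < q'
    · simp only [IsRun, h.turn_add_two hf hg h1 h2.le,
        h.turn_add_two hf hg (h1.trans hq) hqn]
      refine and_congr (by omega) (and_congr Iff.rfl (and_congr Iff.rfl ⟨fun H j h1 h2 => ?_,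
        fun H j h1 h2 => ?_⟩))
      · rw [← h.turn_add_two hf hg (by omega) (by omega)]
        exact H _ (by omega) (by omega)
      · obtain ⟨i, rfl⟩ : ∃ i', j = i' + 2 := ⟨j - 2, by ring⟩
        rw [h.turn_add_two hf hg (by omega) (by omega)]
        exact H _ (by omega) (by omega)
    · exact ⟨fun H => absurd H.1 (by omega), fun H => absurd H.1 hq⟩
  constructor
  · intro H
    have := H.le_add_period hg ((h.turn_left hn hf hg).2 ht) (by omega)
    exact (key (by omega)).1 H
  · intro H
    have := H.le_add_period hf ht h2
    exact (key (by omega)).2 H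

lemma Insertion.typeAt_self (h : Insertion f n g p) : typeAt g p = typeAt f p := by
  rw [typeAt, typeAt, h.fst, h.snd]

lemma Insertion.typeAt_add_two (h : Insertion f n g p) (hf : f.Periodic n)
    (hg : g.Periodic (n + 2)) {p' : ℤ} (h1 : p ≤ p') (h2 : p' ≤ p + n) :
    typeAt g (p' + 2) = typeAt f p' := by
  rw [typeAt, typeAt, add_right_comm, h.apply_add_two hf hg h1 (by omega),
    h.apply_add_two hf hg (by omega) (by omega)]

lemma exists_shift_mem_of_not_dvd (hn : 0 < n) {p' : ℤ} (h : ¬ n ∣ p' - p) :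
    ∃ k : ℤ, p < p' + k * n ∧ p' + k * n < p + n := by
  obtain ⟨k, h1, h2⟩ := exists_shift_mem hn p p'
  refine ⟨k, lt_of_le_of_ne h1 fun h3 => h ⟨-k, by linarith⟩, h2⟩

lemma not_dvd_of_lt_of_lt {p' : ℤ} (h1 : p < p') (h2 : p' < p + n) : ¬ n ∣ p' - p :=
  fun h => absurd (Int.le_of_dvd (by omega) h) (by omega)

lemma not_dvd_sub {i j : ℤ} (h : i ≠ j) (h1 : p < i) (h2 : i < p + n) (h3 : p < j)
    (h4 : j < p + n) : ¬ n ∣ i - j := fun hd => h <| by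
  have := Int.eq_zero_of_abs_lt_dvd hd (abs_lt.2 ⟨by omega, by omega⟩)
  omega

lemma Insertion.dominant_self (h : Insertion f n g p) (hn : 2 ≤ n) (hf : f.Periodic n)
    (hg : g.Periodic (n + 2)) {c q : ℤ} (hq : p < q) :
    Dominant (c + 2) g (n + 2) p (q + 2) ↔ Dominant c f n p q := by
  rw [Dominant, Dominant, h.isRun_self hn hf hg hq, h.typeAt_self]
  refine and_congr_right fun hrun => ⟨fun H p' q' h1 h2 h3 => ?_, fun H p' q' h1 h2 h3 => ?_⟩
  · obtain ⟨k, h4, h5⟩ := exists_shift_mem_of_not_dvd (by omega) h3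
    rw [← isRun_add_period hf k] at h1
    rw [← typeAt_add_period hf k] at h2
    have := H _ _ ((h.isRun_add_two hn hf hg hrun.2.1 h4 h5).2 h1)
      (by rw [h.typeAt_add_two hf hg h4.le h5.le, h2])
      (not_dvd_of_lt_of_lt (by omega) (by omega))
    omega
  · obtain ⟨k, h4, h5⟩ := exists_shift_mem_of_not_dvd (by omega) h3
    rw [← isRun_add_period hg k] at h1
    rw [← typeAt_add_period hg k] at h2
    have h6 : p + 3 ≤ p' + k * (n + 2) := by
      by_contra h7
      exact h.not_turn hn h4 (by omega) h1.2.1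
    generalize p' + k * (n + 2) = i, q' + k * (n + 2) = r,
      (show q' - p' = q' + k * (n + 2) - (p' + k * (n + 2)) by ring) = e at *
    obtain ⟨i, rfl⟩ : ∃ i', i = i' + 2 := ⟨i - 2, by ring⟩
    obtain ⟨r, rfl⟩ : ∃ i', r = i' + 2 := ⟨r - 2, by ring⟩
    rw [h.isRun_add_two hn hf hg hrun.2.1 (by omega) (by omega)] at h1
    rw [h.typeAt_add_two hf hg (by omega) (by omega)] at h2
    have := H _ _ h1 h2 (not_dvd_of_lt_of_lt (by omega) (by omega))
    omega

lemma Insertion.dominant_of_add_two (h : Insertion f n g p) (hn : 2 ≤ n) (hf : f.Periodic n)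
    (hg : g.Periodic (n + 2)) (ht : Turn f p) {c i r : ℤ} (h1 : p < i) (h2 : i < p + n)
    (hty : typeAt g (i + 2) ≠ typeAt g p) (H : Dominant c g (n + 2) (i + 2) (r + 2)) :
    Dominant c f n i r := by
  rw [h.typeAt_self, h.typeAt_add_two hf hg h1.le h2.le] at hty
  refine ⟨(h.isRun_add_two hn hf hg ht h1 h2).1 H.1, fun p' q' h3 h4 h5 => ?_⟩
  obtain ⟨k, h6, h7⟩ := exists_shift_mem (show 0 < n by omega) p p'
  rw [← isRun_add_period hf k] at h3
  rw [← typeAt_add_period hf k] at h4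
  have h8 : p < p' + k * n := lt_of_le_of_ne h6 fun h9 => hty (by rw [← h4, ← h9])
  have h9 : p' + k * n ≠ i := by
    rintro rfl
    exact h5 ⟨-k, by ring⟩
  have := H.2 _ _ ((h.isRun_add_two hn hf hg ht h8 h7).2 h3)
    (by rw [h.typeAt_add_two hf hg h8.le h7.le, h.typeAt_add_two hf hg h1.le h2.le, h4])
    (not_dvd_sub (p := p + 2) (by omega) (by omega) (by omega) (by omega) (by omega))
  omega

lemma Dominant.exists_insertion {c q : ℤ} (H : Dominant (c + 2) g (n + 2) p q) (hn : 2 ≤ n)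
    (hg : g.Periodic (n + 2)) (hq : 3 ≤ q - p) :
    ∃ f : ℤ → Letter, f.Periodic n ∧ Insertion f n g p ∧ Dominant c f n p (q - 2) := by
  have hf : (fun j => g (p + 2 + (j - p) % n)).Periodic n := fun j => by
    simp only
    rw [show j + n - p = j - p + n by ring, Int.add_emod_right]
  have hi : Insertion (fun j => g (p + 2 + (j - p) % n)) n g p := by
    refine ⟨fun j h1 h2 => ?_, ?_, ?_⟩
    · rw [Int.emod_eq_of_lt (by omega) (by omega)]
      congr 1
      ring
    · rw [sub_self, Int.zero_emod, add_zero, H.1.apply_add_two le_rfl (by omega)]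
    · rw [Int.emod_eq_of_lt (by omega) (by omega),
        ← H.1.apply_add_two (j := p + 1) (by omega) (by omega)]
      congr 1
      ring
  refine ⟨_, hf, hi, ?_⟩
  rw [← hi.dominant_self hn hf hg (by omega), sub_add_cancel]
  exact H

lemma Insertion.unique_right {g' : ℤ → Letter} (h : Insertion f n g p)
    (h' : Insertion f n g' p) (hn : 0 < n) (hg : g.Periodic (n + 2))
    (hg' : g'.Periodic (n + 2)) : g = g' := by
  refine periodic_ext (by omega) hg hg' p fun j h1 h2 => ?_
  obtain rfl | rfl | h3 : j = p ∨ j = p + 1 ∨ p + 2 ≤ j := by omega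
  · rw [h.fst, h'.fst]
  · rw [h.snd, h'.snd]
  · obtain ⟨i, rfl⟩ : ∃ i', j = i' + 2 := ⟨j - 2, by ring⟩
    rw [h.tail i (by omega) (by omega), h'.tail i (by omega) (by omega)]

lemma Insertion.unique_left {f' : ℤ → Letter} (h : Insertion f n g p)
    (h' : Insertion f' n g p) (hn : 0 < n) (hf : f.Periodic n) (hf' : f'.Periodic n) :
    f = f' :=
  periodic_ext hn hf hf' p fun j h1 h2 => by rw [← h.tail j h1 h2, h'.tail j h1 h2]

lemma Insertion.shift (h : Insertion f n g p) (k : ℤ) :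
    Insertion (fun j => f (j + k)) n (fun j => g (j + k)) (p - k) := by
  refine ⟨fun j h1 h2 => ?_, ?_, ?_⟩
  · rw [add_right_comm, h.tail _ (by omega) (by omega)]
  · rw [sub_add_cancel, h.fst]
  · rw [show p - k + 1 + k = p + 1 by ring, h.snd]

lemma Insertion.reflect (h : Insertion f n g p) (hf : f.Periodic n)
    (hg : g.Periodic (n + 2)) {q : ℤ} (hrun : IsRun f p q) (hn : 2 ≤ n) (k : ℤ) :
    Insertion (fun j => f (k - j)) n (fun j => g (k + 2 - j)) (k - q) := by
  have hq := hrun.1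
  have hqn := hrun.le_add_period hf hrun.2.1 (by omega)
  refine ⟨fun j h1 h2 => ?_, ?_, ?_⟩
  · rw [add_sub_add_right_eq_sub]
    obtain ⟨i, rfl⟩ : ∃ i, j = k - i := ⟨k - j, by ring⟩
    rw [sub_sub_cancel]
    obtain h3 | rfl | rfl | h3 : i < p ∨ i = p ∨ i = p + 1 ∨ p + 2 ≤ i := by omega
    · rw [← hg, ← hf, ← add_assoc, h.apply_add_two hf hg (by omega) (by omega)]
    · exact h.fst
    · exact h.snd
    · obtain ⟨i, rfl⟩ : ∃ i', i = i' + 2 := ⟨i - 2, by ring⟩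
      rw [h.apply_add_two hf hg (by omega) (by omega),
        hrun.apply_add_two (by omega) (by omega)]
  · rw [show k + 2 - (k - q) = q + 2 by ring, sub_sub_cancel,
      h.apply_add_two hf hg (by omega) (by omega)]
  · rw [show k + 2 - (k - q + 1) = q - 1 + 2 by ring, show k - (k - q + 1) = q - 1 by ring,
      h.apply_add_two hf hg (by omega) (by omega)]

end Insertion

lemma periodic_shift {f : ℤ → Letter} {n : ℤ} (hf : f.Periodic n) (k : ℤ) :
    (fun j => f (j + k)).Periodic n := fun j => by
  simp only
  rw [add_right_comm, hf]

lemma periodic_reflect {f : ℤ → Letter} {n : ℤ} (hf : f.Periodic n) (k : ℤ) :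
    (fun j => f (k - j)).Periodic n := fun j => by
  simp only
  rw [← hf, show k - (j + n) + n = k - j by ring]

lemma dihedralEquiv_refl (f : ℤ → Letter) : DihedralEquiv f f := ⟨0, Or.inl fun j => by simp⟩

lemma DihedralEquiv.symm {f g : ℤ → Letter} (h : DihedralEquiv f g) : DihedralEquiv g f := by
  obtain ⟨k, h | h⟩ := h
  · exact ⟨-k, Or.inl fun j => by rw [h]; congr 1; ring⟩
  · exact ⟨k, Or.inr fun j => by rw [h, sub_sub_cancel]⟩

lemma DihedralEquiv.trans {f g h : ℤ → Letter} (h1 : DihedralEquiv f g)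
    (h2 : DihedralEquiv g h) : DihedralEquiv f h := by
  obtain ⟨k, h1 | h1⟩ := h1 <;> obtain ⟨l, h2 | h2⟩ := h2
  · exact ⟨k + l, Or.inl fun j => by rw [h2, h1]; congr 1; ring⟩
  · exact ⟨k + l, Or.inr fun j => by rw [h2, h1]; congr 1; ring⟩
  · exact ⟨k - l, Or.inr fun j => by rw [h2, h1]; congr 1; ring⟩
  · exact ⟨k - l, Or.inl fun j => by rw [h2, h1]; congr 1; ring⟩

lemma Dominant.exists_of_dihedralEquiv {f f' : ℤ → Letter} {c n p q : ℤ}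
    (h : Dominant c f n p q) (hf : f.Periodic n) (he : DihedralEquiv f f') :
    ∃ p' q', Dominant c f' n p' q' ∧ q' - p' = q - p := by
  obtain ⟨k, he | he⟩ := he <;> obtain rfl := funext he
  · exact ⟨p - 2 * k, q - 2 * k, (dominant_comp_add _ _ _).2 (by simpa using h), by ring⟩
  · exact ⟨2 * k + 1 - q, 2 * k + 1 - p, h.reflect hf _, by ring⟩

section Insertion

variable {f g : ℤ → Letter} {n p q c : ℤ}

lemma Insertion.exists_of_dihedralEquiv_left {f' : ℤ → Letter} (h : Insertion f n g p)
    (hn : 2 ≤ n) (hf : f.Periodic n) (hg : g.Periodic (n + 2)) (hd : Dominant c f n p q)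
    (he : DihedralEquiv f f') :
    ∃ g' p' q', g'.Periodic (n + 2) ∧ Insertion f' n g' p' ∧ Dominant c f' n p' q' ∧
      DihedralEquiv g g' := by
  obtain ⟨k, he | he⟩ := he <;> obtain rfl := funext he
  · exact ⟨_, _, q - 2 * k, periodic_shift hg _, h.shift (2 * k),
      (dominant_comp_add _ _ _).2 (by simpa using hd), ⟨k, Or.inl fun _ => rfl⟩⟩
  · exact ⟨_, _, _, periodic_reflect hg _, h.reflect hf hg hd.1 hn (2 * k + 1),
      hd.reflect hf _, ⟨k + 1, Or.inr fun j => by dsimp only; congr 1; ring⟩⟩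

lemma Insertion.exists_of_dihedralEquiv_right {g' : ℤ → Letter} (h : Insertion f n g p)
    (hn : 2 ≤ n) (hf : f.Periodic n) (hg : g.Periodic (n + 2)) (hd : Dominant c f n p q)
    (he : DihedralEquiv g g') :
    ∃ f' p' q', f'.Periodic n ∧ Insertion f' n g' p' ∧ Dominant c f' n p' q' ∧
      DihedralEquiv f f' := by
  obtain ⟨k, he | he⟩ := he <;> obtain rfl := funext he
  · exact ⟨_, _, q - 2 * k, periodic_shift hf _, h.shift (2 * k),
      (dominant_comp_add _ _ _).2 (by simpa using hd), ⟨k, Or.inl fun _ => rfl⟩⟩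
  · have := h.reflect hf hg hd.1 hn (2 * k - 1)
    rw [show 2 * k - 1 + 2 = 2 * k + 1 by ring] at this
    exact ⟨_, _, _, periodic_reflect hf _, this,
      hd.reflect hf _, ⟨k - 1, Or.inr fun j => by dsimp only; congr 1; ring⟩⟩

/-- Deletions at two dominant runs in different positions commute. -/
lemma Insertion.exists_common_deletion {f₁ f₂ : ℤ → Letter} {p₁ p₂ q₁ q₂ : ℤ} (hn : 2 ≤ n)
    (hf₁ : f₁.Periodic n) (hf₂ : f₂.Periodic n) (hg : g.Periodic (n + 2))
    (h₁ : Insertion f₁ n g p₁) (h₂ : Insertion f₂ n g p₂)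
    (hd₁ : Dominant 0 f₁ n p₁ q₁) (hd₂ : Dominant 0 f₂ n p₂ q₂)
    (hlt : p₁ < p₂) (hlt' : p₂ < p₁ + (n + 2)) :
    ∃ m k₁ k₂ i₁ i₂ r₁ r₂, n = m + 2 ∧ 2 ≤ m ∧ k₁.Periodic m ∧ k₂.Periodic m ∧
      Insertion k₁ m f₁ i₁ ∧ Insertion k₂ m f₂ i₂ ∧
      Dominant 0 k₁ m i₁ r₁ ∧ Dominant 0 k₂ m i₂ r₂ ∧ DihedralEquiv k₁ k₂ := by
  have hq₁ := hd₁.1.1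
  have hq₂ := hd₂.1.1
  have hg₁ := (h₁.dominant_self hn hf₁ hg hq₁).2 hd₁
  have hg₂ := (h₂.dominant_self hn hf₂ hg hq₂).2 hd₂
  have hle : q₁ + 2 ≤ p₂ := by
    by_contra hlt
    exact hg₁.1.2.2.2 p₂ (by omega) (by omega) hg₂.1.2.1
  have hle' : q₂ + 2 ≤ p₁ + (n + 2) := hg₂.1.le_add_period hg hg₁.1.2.1 hlt'
  have hty : typeAt g p₂ ≠ typeAt g p₁ := fun he => by
    have hnd := not_dvd_of_lt_of_lt hlt hlt'
    have a := hg₁.2 _ _ hg₂.1 he hnd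
    have b := hg₂.2 _ _ hg₁.1 he.symm (by rwa [← dvd_neg, neg_sub])
    omega
  have hc₁ : Dominant 2 f₁ n (p₂ - 2) q₂ :=
    h₁.dominant_of_add_two hn hf₁ hg hd₁.1.2.1 (by omega) (by omega)
      (by rwa [sub_add_cancel]) (by rwa [sub_add_cancel])
  have hc₂ : Dominant 2 f₂ n (p₁ + n) (q₁ + n + 2) := by
    have e := typeAt_add_period hg 1 p₁
    have d := (dominant_add_period hg 1 _ _).2 hg₁
    rw [show p₁ + 1 * (n + 2) = p₁ + n + 2 by ring] at e d
    rw [show q₁ + 2 + 1 * (n + 2) = q₁ + n + 2 + 2 by ring] at d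
    exact h₂.dominant_of_add_two hn hf₂ hg hd₂.1.2.1 (by omega) (by omega)
      (by rw [e]; exact hty.symm) d
  obtain ⟨m, rfl⟩ : ∃ m, n = m + 2 := ⟨n - 2, by ring⟩
  obtain ⟨k₁, hk₁, hi₁, hr₁⟩ := Dominant.exists_insertion (c := 0) hc₁ (by omega) hf₁ (by omega)
  obtain ⟨k₂, hk₂, hi₂, hr₂⟩ := Dominant.exists_insertion (c := 0) hc₂ (by omega) hf₂ (by omega)
  refine ⟨m, k₁, k₂, _, _, _, _, rfl, by omega, hk₁, hk₂, hi₁, hi₂, hr₁, hr₂, -1, Or.inl ?_⟩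
  refine congrFun (periodic_ext (show 0 < m by omega) hk₂ (periodic_shift hk₁ _)
    (p₁ + (m + 2)) fun j hj hj' => ?_)
  have a : ∀ i, p₂ - 2 ≤ i → i ≤ p₂ - 2 + m + 1 → f₁ (i + 2) = k₁ i := fun i =>
    hi₁.apply_add_two hk₁ hf₁
  have b : ∀ i, p₁ ≤ i → i ≤ p₁ + (m + 2) + 1 → g (i + 2) = f₁ i := fun i =>
    h₁.apply_add_two hf₁ hg
  have b' : ∀ i, p₂ ≤ i → i ≤ p₂ + (m + 2) + 1 → g (i + 2) = f₂ i := fun i =>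
    h₂.apply_add_two hf₂ hg
  rw [← hi₂.tail j hj hj', show j + 2 * -1 = j - 2 by ring]
  rcases le_or_gt (p₂ + (m + 2)) j with hj2 | hj2
  · rw [← hk₁.sub_eq, ← a _ (by omega) (by omega), ← b _ (by omega) (by omega),
      ← hf₂.sub_eq, ← b' _ (by omega) (by omega)]
    congr 1
    ring
  · rw [← b' _ (by omega) (by omega), ← a _ (by omega) (by omega)]
    rw [sub_add_cancel, ← hf₁.sub_eq, ← b _ (by omega) (by omega), ← hg (j - (m + 2) + 2)]
    congr 1
    ring

end Insertion

/-- A cyclically reduced cyclic word of even length, unrolled to a periodic bi-infinite word. -/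
structure CyclicWord where
  toFun : ℤ → Letter
  period : ℤ
  two_le : 2 ≤ period
  even : 2 ∣ period
  periodic : toFun.Periodic period
  reduced : Reduced toFun

namespace CyclicWord

/-- Equality of cyclic words up to even rotation and reversal. -/
def Equiv (F G : CyclicWord) : Prop := F.period = G.period ∧ DihedralEquiv F.toFun G.toFun

/-- `F` is obtained from `G` by contracting a run that remains distinguished, up to
equivalence. -/
def Contracts (G F : CyclicWord) : Prop :=
  G.period = F.period + 2 ∧ ∃ g p q, Dominant 0 F.toFun F.period p q ∧
    Insertion F.toFun F.period g p ∧ g.Periodic (F.period + 2) ∧ DihedralEquiv g G.toFun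

/-- Every run of length at least four is at most two letters longer than another run of its
type. -/
def IsMotif (F : CyclicWord) : Prop :=
  ∀ p q, Dominant 2 F.toFun F.period p q → q - p < 3

lemma Equiv.symm {F G : CyclicWord} (h : F.Equiv G) : G.Equiv F := ⟨h.1.symm, h.2.symm⟩

lemma Equiv.trans {F G H : CyclicWord} (h : F.Equiv G) (h' : G.Equiv H) : F.Equiv H :=
  ⟨h.1.trans h'.1, h.2.trans h'.2⟩

lemma Contracts.of_equiv_left {G G' F : CyclicWord} (h : G.Contracts F) (he : G.Equiv G') :
    G'.Contracts F := by
  obtain ⟨h1, g, p, q, h2, h3, h4, h5⟩ := h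
  exact ⟨he.1 ▸ h1, g, p, q, h2, h3, h4, h5.trans he.2⟩

/-- Replace the underlying function of a contraction by one inserted exactly into `G`. -/
lemma Contracts.exists_insertion {G F : CyclicWord} (h : G.Contracts F) :
    ∃ f p q, f.Periodic F.period ∧ Insertion f F.period G.toFun p ∧
      Dominant 0 f F.period p q ∧ DihedralEquiv F.toFun f := by
  obtain ⟨h1, g, p, q, h2, h3, h4, h5⟩ := h
  exact h3.exists_of_dihedralEquiv_right F.two_le F.periodic h4 h2 h5

lemma Contracts.join {G F₁ F₂ : CyclicWord} (h₁ : G.Contracts F₁) (h₂ : G.Contracts F₂) :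
    F₁.Equiv F₂ ∨ ∃ H, F₁.Contracts H ∧ F₂.Contracts H := by
  have hn : F₁.period = F₂.period := by have := h₁.1; have := h₂.1; omega
  have hG := h₁.1
  obtain ⟨f₁, p₁, q₁, hp₁, hi₁, hd₁, he₁⟩ := h₁.exists_insertion
  obtain ⟨f₂, p₂, q₂, hp₂, hi₂, hd₂, he₂⟩ := h₂.exists_insertion
  have hg := G.periodic
  have h2 := F₁.two_le
  have hev := F₁.even
  rw [← hn] at hp₂ hi₂ hd₂
  rw [hG] at hg
  obtain ⟨k, hk, hk'⟩ := exists_shift_mem (show 0 < F₁.period + 2 by omega) p₁ p₂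
  have hi₃ := hi₂.shift (-k * (F₁.period + 2))
  have hd₃ := (dominant_comp_add (f := f₂) (c := 0) (n := F₁.period) (-k * (F₁.period + 2))
    (p₂ - -k * (F₁.period + 2)) (q₂ - -k * (F₁.period + 2))).2 (by simpa using hd₂)
  have hp₃ := periodic_shift hp₂ (-k * (F₁.period + 2))
  have he₃ : DihedralEquiv f₂ (fun j => f₂ (j + -k * (F₁.period + 2))) := by
    obtain ⟨m, hm⟩ := hev
    exact ⟨-k * (m + 1), Or.inl fun j => by dsimp only; rw [hm]; congr 1; ring⟩
  rw [comp_add_eq hg] at hi₃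
  rw [show p₂ - -k * (F₁.period + 2) = p₂ + k * (F₁.period + 2) by ring] at hi₃ hd₃
  generalize (fun j => f₂ (j + -k * (F₁.period + 2))) = f₃ at *
  generalize p₂ + k * (F₁.period + 2) = p₃, q₂ - -k * (F₁.period + 2) = q₃ at *
  replace he₃ := he₂.trans he₃
  rcases hk.eq_or_lt with rfl | hlt
  · obtain rfl := hi₁.unique_left hi₃ (by omega) hp₁ hp₃
    exact Or.inl ⟨hn, he₁.trans he₃.symm⟩
  right
  obtain ⟨m, k₁, k₂, i₁, i₂, r₁, r₂, hm, hm2, hk₁, hk₂, hj₁, hj₂, hl₁, hl₂, he⟩ :=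
    hi₁.exists_common_deletion h2 hp₁ hp₃ hg hi₃ hd₁ hd₃ hlt hk'
  rw [hm] at hp₁ hev hn
  have hr : Reduced k₁ := by
    refine hj₁.reduced_left (by omega) hk₁ hp₁ (hi₁.reduced_left (by omega) (hm ▸ hp₁) hg
      G.reduced)
  let H : CyclicWord := ⟨k₁, m, hm2, by omega, hk₁, hr⟩
  obtain ⟨g₂, s, t, hg₂, hs, ht, hgg⟩ :=
    hj₂.exists_of_dihedralEquiv_left hm2 hk₂ (hm ▸ hp₃) hl₂ he.symm
  exact ⟨H, ⟨hm, f₁, i₁, r₁, hl₁, hj₁, hp₁, he₁.symm⟩,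
    ⟨hn.symm, g₂, s, t, ht, hs, hg₂, hgg.symm.trans he₃.symm⟩⟩

lemma IsMotif.not_contracts {G F : CyclicWord} (h : G.IsMotif) : ¬ G.Contracts F := by
  intro hc
  have hG := hc.1
  obtain ⟨f, p, q, hp, hi, hd, -⟩ := hc.exists_insertion
  have hg := G.periodic
  rw [hG] at hg
  have := h p (q + 2) (by rw [hG]; exact (hi.dominant_self F.two_le hp hg hd.1.1).2 hd)
  have := hd.1.1
  omega

lemma IsMotif.of_equiv {F G : CyclicWord} (h : F.IsMotif) (he : F.Equiv G) : G.IsMotif := by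
  intro p q hd
  obtain ⟨p', q', h1, h2⟩ := hd.exists_of_dihedralEquiv G.periodic he.2.symm
  rw [← h2]
  exact h p' q' (he.1 ▸ h1)

/-- One step of reduction, including the replacement by an equivalent cyclic word. -/
def Reduces (G F : CyclicWord) : Prop := G.Equiv F ∨ G.Contracts F

lemma IsMotif.equiv_of_reduces {G F : CyclicWord} (h : G.IsMotif)
    (hr : Relation.ReflTransGen Reduces G F) : G.Equiv F := by
  induction hr with
  | refl => exact ⟨rfl, dihedralEquiv_refl _⟩
  | tail _ hs ih =>
    rcases hs with hs | hs
    · exact ih.trans hs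
    · exact absurd hs (h.of_equiv ih).not_contracts

lemma equiv_of_isMotif {G F₁ F₂ : CyclicWord} (h₁ : Relation.ReflTransGen Reduces G F₁)
    (h₂ : Relation.ReflTransGen Reduces G F₂) (hm₁ : F₁.IsMotif) (hm₂ : F₂.IsMotif) :
    F₁.Equiv F₂ := by
  obtain ⟨H, hH₁, hH₂⟩ := Relation.church_rosser (r := Reduces) (fun A B C hB hC => by
    rcases hB with hB | hB
    · refine ⟨C, .single ?_, .refl⟩
      rcases hC with hC | hC
      · exact Or.inl (hB.symm.trans hC)
      · exact Or.inr (hC.of_equiv_left hB)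
    · rcases hC with hC | hC
      · exact ⟨B, .refl, .single (Or.inr (hB.of_equiv_left hC))⟩
      · rcases hB.join hC with h | ⟨D, hD, hD'⟩
        · exact ⟨C, .single (Or.inl h), .refl⟩
        · exact ⟨D, .single (Or.inr hD), .single (Or.inr hD')⟩) h₁ h₂
  exact (hm₁.equiv_of_reduces hH₁).trans (hm₂.equiv_of_reduces hH₂).symm

end CyclicWord

/-- The periodic bi-infinite word read off a cyclic word. -/
def unroll (w : List Letter) (j : ℤ) : Letter := cget w (j % w.length).toNat

lemma unroll_natCast (w : List Letter) (i : ℕ) : unroll w i = cget w i := by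
  rw [unroll, ← Int.natCast_mod, Int.toNat_natCast, cget, cget, Nat.mod_mod]

lemma unroll_eq_getElem (w : List Letter) {i : ℕ} (h : i < w.length) : unroll w i = w[i] := by
  rw [unroll_natCast, cget, Nat.mod_eq_of_lt h, List.getD_eq_getElem _ _ h]

lemma unroll_periodic (w : List Letter) : (unroll w).Periodic w.length := fun j => by
  rw [unroll, unroll, Int.add_emod_right]

lemma unroll_ext {w : List Letter} {f : ℤ → Letter} (hf : f.Periodic w.length) (hw : w ≠ [])
    (h : ∀ (i : ℕ) (hi : i < w.length), w[i] = f i) : unroll w = f := by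
  have := List.length_pos_iff.2 hw
  refine periodic_ext (by omega) (unroll_periodic w) hf 0 fun j h1 h2 => ?_
  lift j to ℕ using h1
  rw [unroll_eq_getElem w (by omega)]
  exact h j _

lemma unroll_injective {u v : List Letter} (hl : u.length = v.length)
    (h : unroll u = unroll v) : u = v :=
  List.ext_getElem hl fun i h1 h2 => by
    rw [← unroll_eq_getElem u h1, h, unroll_eq_getElem v h2]

lemma unroll_rotate {w : List Letter} (hw : w ≠ []) (k : ℕ) :
    unroll (w.rotate k) = fun j => unroll w (j + k) := by
  refine unroll_ext ?_ (by simpa using hw) fun i hi => ?_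
  · rw [List.length_rotate]
    exact periodic_shift (unroll_periodic w) k
  · have := List.length_pos_iff.2 hw
    rw [List.getElem_rotate, ← Nat.cast_add, unroll_natCast, cget, List.getD_eq_getElem]

lemma unroll_reverse {w : List Letter} (hw : w ≠ []) :
    unroll w.reverse = fun j => unroll w (w.length - 1 - j) := by
  refine unroll_ext ?_ (by simpa using hw) fun i hi => ?_
  · rw [List.length_reverse]
    exact periodic_reflect (unroll_periodic w) _
  · rw [List.length_reverse] at hi
    rw [List.getElem_reverse, ← unroll_eq_getElem]
    congr 1
    omega

lemma cyclRed_iff {w : List Letter} (hw : w ≠ []) : CyclRed w ↔ Reduced (unroll w) := by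
  have hpos := List.length_pos_iff.2 hw
  refine ⟨fun h j => ?_, fun h => ⟨hw, fun i _ => ?_⟩⟩
  · obtain ⟨k, h1, h2⟩ := exists_shift_mem (show (0 : ℤ) < w.length by omega) 0 j
    rw [← periodic_add_mul (unroll_periodic w) k j,
      ← periodic_add_mul (unroll_periodic w) k (j + 1), add_right_comm]
    generalize j + k * (w.length : ℤ) = i at h1 h2
    lift i to ℕ using h1
    have := h.2 i (by omega)
    rwa [← unroll_natCast, ← unroll_natCast, Nat.cast_succ] at this
  · rw [← unroll_natCast, ← unroll_natCast, Nat.cast_succ]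
    exact h i

lemma wordEquiv_iff {u v : List Letter} (hu : u ≠ []) (he : 2 ∣ u.length) :
    WordEquiv u v ↔ u.length = v.length ∧ DihedralEquiv (unroll u) (unroll v) := by
  obtain ⟨m, hm⟩ := he
  have hpos := List.length_pos_iff.2 hu
  have hur : u.reverse ≠ [] := by simpa using hu
  have hm' : (u.length : ℤ) = 2 * m := by omega
  constructor
  · rintro ⟨_, ⟨k, rfl⟩, rfl | rfl⟩
    · refine ⟨by simp, k, Or.inl fun j => ?_⟩
      rw [unroll_rotate hu]
      push_cast
      rfl
    · refine ⟨by simp, m - 1 - k, Or.inr fun j => ?_⟩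
      rw [unroll_rotate hur, unroll_reverse hu]
      dsimp only
      congr 1
      rw [hm']
      push_cast
      ring
  · rintro ⟨hl, k, hk | hk⟩
    · obtain ⟨r, h1, -⟩ := exists_shift_mem (show (0 : ℤ) < m by omega) 0 k
      refine ⟨2 * (k + r * m).toNat, ⟨_, rfl⟩, Or.inl (unroll_injective (by simp [hl]) ?_)⟩
      rw [unroll_rotate hu]
      funext j
      rw [hk, ← periodic_add_mul (unroll_periodic u) r, hm', Nat.cast_mul, Int.toNat_of_nonneg h1]
      congr 1
      push_cast
      ring
    · obtain ⟨r, h1, -⟩ := exists_shift_mem (show (0 : ℤ) < m by omega) 0 (-1 - k)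
      refine ⟨2 * (-1 - k + r * m).toNat, ⟨_, rfl⟩,
        Or.inr (unroll_injective (by simp [hl]) ?_)⟩
      rw [unroll_rotate hur, unroll_reverse hu]
      funext j
      rw [hk, ← periodic_add_mul (unroll_periodic u) (1 - r), hm', Nat.cast_mul,
        Int.toNat_of_nonneg h1]
      congr 1
      push_cast
      ring

lemma Reduced.exists_type_iff {f : ℤ → Letter} (hf : Reduced f) (i : ℤ) (len : ℕ) :
    (∃ T : Finset Letter, T.card = 2 ∧ ∀ j : ℕ, j < len → f (i + j) ∈ T) ↔
      ∀ j, i < j → j < i + len - 1 → ¬ Turn f j := by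
  constructor
  · rintro ⟨T, hT, h⟩ j h1 h2 ht
    obtain ⟨m, rfl⟩ : ∃ m : ℕ, j = i + (m + 1) := ⟨(j - i - 1).toNat, by omega⟩
    have a := h m (by omega)
    have b := h (m + 1) (by omega)
    have c := h (m + 2) (by omega)
    have h3 := hf (i + m)
    have h4 := hf (i + m + 1)
    rw [Turn] at ht
    push_cast at b c
    rw [show i + (m + 1 : ℤ) - 1 = i + m by ring, show i + (m + 1 : ℤ) + 1 = i + m + 2 by ring]
      at ht
    rw [show i + m + 1 + 1 = i + m + 2 by ring] at h4
    rw [← add_assoc] at b c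
    have : ({f (i + m), f (i + m + 1), f (i + m + 2)} : Finset Letter) ⊆ T := by
      intro a ha
      simp only [Finset.mem_insert, Finset.mem_singleton] at ha
      rcases ha with rfl | rfl | rfl <;> assumption
    have := Finset.card_le_card this
    rw [Finset.card_eq_three.2 ⟨_, _, _, h3, ht, h4, rfl⟩] at this
    omega
  · intro h
    refine ⟨{f i, f (i + 1)}, Finset.card_pair (hf i), fun j => ?_⟩
    induction j using Nat.strong_induction_on with
    | _ j ih =>
      intro hj
      match j with
      | 0 => simp
      | 1 => simp
      | j + 2 =>
        have := h (i + (j + 1 : ℤ)) (by omega) (by omega)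
        rw [Turn, not_not] at this
        rw [show i + ((j + 2 : ℕ) : ℤ) = i + (j + 1) + 1 by push_cast; ring, ← this,
          show i + (j + 1 : ℤ) - 1 = i + j by ring]
        exact ih j (by omega) (by omega)

lemma runAt_iff {w : List Letter} (h : Reduced (unroll w)) {i len : ℕ} :
    RunAt w i len ↔ i < w.length ∧ 2 ≤ len ∧ len < w.length ∧
      IsRun (unroll w) i (i + len - 1) := by
  rw [RunAt]
  refine and_congr_right fun hi => and_congr_right fun hlen => and_congr_right fun _ => ?_
  simp only [← unroll_natCast]
  have e : ∀ j : ℕ, ((i + w.length - 1 + j : ℕ) : ℤ) = (i - 1 : ℤ) + j + w.length := by omega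
  simp only [e, unroll_periodic w _, Nat.cast_add]
  rw [h.exists_type_iff, h.exists_type_iff, h.exists_type_iff]
  constructor
  · rintro ⟨h1, h2, h3⟩
    push Not at h2 h3
    obtain ⟨j, h4, h5, h6⟩ := h2
    obtain ⟨l, h7, h8, h9⟩ := h3
    have hj : j = i + len - 1 := by
      by_contra hne
      exact h1 j h4 (by omega) h6
    have hl : l = i := by
      by_contra hne
      exact h1 l (by omega) (by omega) h9
    subst hj hl
    exact ⟨by omega, h9, h6, h1⟩
  · rintro ⟨h1, h2, h3, h4⟩
    exact ⟨h4, fun h5 => h5 _ h1 (by omega) h3, fun h5 => h5 _ (by omega) (by omega) h2⟩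

lemma runType_eq (w : List Letter) (i : ℕ) : runType w i = typeAt (unroll w) i := by
  rw [runType, typeAt, ← unroll_natCast, ← unroll_natCast, Nat.cast_succ]

/-- A run of the periodic word is, up to a period, one of the runs of the cyclic word. -/
lemma IsRun.exists_runAt {w : List Letter} (h : Reduced (unroll w)) (hw : 2 ≤ w.length)
    {p q : ℤ} (hr : IsRun (unroll w) p q) :
    ∃ (k : ℤ) (i len : ℕ), p + k * w.length = i ∧ q + k * w.length = i + len - 1 ∧
      RunAt w i len := by
  obtain ⟨k, h1, h2⟩ := exists_shift_mem (show (0 : ℤ) < w.length by omega) 0 p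
  have h3 := hr.length_lt (by omega) (unroll_periodic w) h
  have h4 := hr.1
  have h5 := (isRun_add_period (unroll_periodic w) k p q).2 hr
  refine ⟨k, (p + k * w.length).toNat, (q - p + 1).toNat, by omega, by omega, ?_⟩
  rw [runAt_iff h]
  refine ⟨by omega, by omega, by omega, ?_⟩
  convert h5 using 1 <;> omega

lemma natCast_dvd_sub_iff {n i j : ℕ} (hi : i < n) (hj : j < n) :
    (n : ℤ) ∣ i - j ↔ i = j := by
  constructor
  · intro hd
    have := Int.eq_zero_of_abs_lt_dvd hd (abs_lt.2 ⟨by omega, by omega⟩)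
    omega
  · rintro rfl
    simp

lemma dominant_iff {w : List Letter} (h : Reduced (unroll w)) (hw : 2 ≤ w.length) {c : ℤ}
    {i len : ℕ} (hr : RunAt w i len) :
    Dominant c (unroll w) w.length i (i + len - 1) ↔
      ∀ i' len', RunAt w i' len' → runType w i' = runType w i → i' ≠ i →
        (len' : ℤ) + c < len := by
  have hr' := (runAt_iff h).1 hr
  constructor
  · intro H i' len' h1 h2 h3
    have h1' := (runAt_iff h).1 h1
    have := H.2 _ _ h1'.2.2.2 (by rwa [← runType_eq, ← runType_eq])
      (by rwa [natCast_dvd_sub_iff h1'.1 hr.1])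
    omega
  · refine fun H => ⟨hr'.2.2.2, fun p' q' h1 h2 h3 => ?_⟩
    obtain ⟨k, i', len', h4, h5, h6⟩ := h1.exists_runAt h hw
    rw [← typeAt_add_period (unroll_periodic w) k, h4, ← runType_eq, ← runType_eq] at h2
    have := H i' len' h6 h2 fun h7 => h3 ⟨-k, by rw [← h7]; linarith⟩
    omega

lemma DistinguishedRun.dominant {w : List Letter} (h : Reduced (unroll w))
    (hw : 2 ≤ w.length) {i len : ℕ} (hd : DistinguishedRun w i len) :
    Dominant 0 (unroll w) w.length i (i + len - 1) := by
  rw [dominant_iff h hw hd.1]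
  intro i' len' h1 h2 h3
  have := hd.2 i' len' h1 h2 h3
  omega

/-- A dominant run of the periodic word is, up to a period, a run of the cyclic word. -/
lemma Dominant.exists_runAt {w : List Letter} (h : Reduced (unroll w)) (hw : 2 ≤ w.length)
    {c p q : ℤ} (hd : Dominant c (unroll w) w.length p q) :
    ∃ (k : ℤ) (i len : ℕ), p + k * w.length = i ∧ q + k * w.length = i + len - 1 ∧
      RunAt w i len ∧ Dominant c (unroll w) w.length i (i + len - 1) := by
  obtain ⟨k, i, len, h1, h2, h3⟩ := hd.1.exists_runAt h hw
  refine ⟨k, i, len, h1, h2, h3, ?_⟩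
  rwa [← h2, ← h1, dominant_add_period (unroll_periodic w)]

lemma motifCond_iff {w : List Letter} (h : Reduced (unroll w)) (hw : 2 ≤ w.length) :
    MotifCond w ↔ ∀ p q, Dominant 2 (unroll w) w.length p q → q - p < 3 := by
  constructor
  · intro H p q hd
    obtain ⟨k, i, len, h1, h2, h3, h4⟩ := hd.exists_runAt h hw
    by_contra hlt
    obtain ⟨i', len', h5, h6, h7, h8⟩ := H i len h3 (by omega)
    have := (dominant_iff h hw h3).1 h4 i' len' h5 h6 h7
    omega
  · intro H i len h1 h2
    by_contra hne
    push Not at hne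
    have := H _ _ ((dominant_iff h hw h1).2 fun i' len' h3 h4 h5 => by
      have := hne i' len' h3 h4 h5
      omega)
    omega

lemma length_expandAt (w : List Letter) (i : ℕ) : (expandAt w i).length = w.length + 2 := by
  simp only [expandAt, List.length_append, List.length_take, List.length_drop,
    List.length_cons, List.length_nil]
  omega

lemma insertion_expandAt {w : List Letter} {i : ℕ} (hi : i < w.length) :
    Insertion (unroll w) w.length (unroll (expandAt w i)) i := by
  have hw : w ≠ [] := List.ne_nil_of_length_pos (by omega)
  have hrot : (expandAt w i).rotate i = [cget w i, cget w (i + 1)] ++ w.rotate i := by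
    have hl : (w.take i).length = i := List.length_take_of_le hi.le
    conv_lhs => rw [expandAt, List.append_assoc]
    rw [show ∀ l : List Letter, (w.take i ++ l).rotate i = l ++ w.take i from fun l => by
      simpa only [hl] using List.rotate_append_length_eq (w.take i) l,
      List.rotate_eq_drop_append_take hi.le, List.append_assoc]
  have hne : expandAt w i ≠ [] := List.ne_nil_of_length_pos (by rw [length_expandAt]; omega)
  have key : ∀ m : ℕ, unroll (expandAt w i) (m + i) =
      unroll ([cget w i, cget w (i + 1)] ++ w.rotate i) m := fun m => by
    rw [← hrot, unroll_rotate hne]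
  refine ⟨fun j h1 h2 => ?_, ?_, ?_⟩
  · obtain ⟨m, rfl⟩ : ∃ m : ℕ, j = i + m := ⟨(j - i).toNat, by omega⟩
    have := key (m + 2)
    rw [unroll_eq_getElem _ (by simp; omega), List.getElem_append_right (by simp),
      ← unroll_eq_getElem] at this
    convert this using 1
    · congr 1
      push_cast
      ring
    · rw [unroll_rotate hw]
      simp [add_comm]
  · have := key 0
    rw [unroll_eq_getElem _ (by simp)] at this
    simpa [unroll_natCast] using this
  · have := key 1
    rw [unroll_eq_getElem _ (by simp)] at this
    rw [← Nat.cast_succ, unroll_natCast w]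
    simpa [add_comm] using this

lemma exists_unroll_eq {f : ℤ → Letter} {n : ℕ} (hn : 0 < n) (hf : f.Periodic n) :
    ∃ w : List Letter, w.length = n ∧ unroll w = f := by
  have hl : (List.ofFn fun i : Fin n => f (i : ℕ)).length = n := List.length_ofFn
  refine ⟨_, hl, unroll_ext ?_ (List.ne_nil_of_length_pos (by omega)) fun i hi => by simp⟩
  rwa [hl]

lemma Dominant.primitive {w : List Letter} (hw : w ≠ []) {p q : ℤ}
    (hd : Dominant 0 (unroll w) w.length p q) : Primitive w := by
  rintro ⟨u, k, hk, hlt, j, h⟩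
  have hpos := List.length_pos_iff.2 hw
  have hrot : (w.rotate j).rotate u.length = w.rotate j := by
    obtain ⟨k, rfl⟩ : ∃ k', k = k' + 1 := ⟨k - 1, by omega⟩
    rw [h]
    conv_lhs => rw [List.replicate_succ, List.flatten_cons, List.rotate_append_length_eq]
    rw [List.replicate_succ', List.flatten_append, List.flatten_singleton]
  have hper : (unroll w).Periodic u.length := fun x => by
    have := congrFun (unroll_rotate (w := w.rotate j) (by simpa using hw) u.length) (x - j)
    rw [hrot, unroll_rotate hw] at this
    simp only [sub_add_cancel] at this
    rw [this]
    congr 1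
    ring
  have hlen : w.length = k * u.length := by
    have := congrArg List.length h
    simpa using this
  have hu : 0 < u.length := by
    by_contra h0
    rw [show u.length = 0 by omega] at hlen
    omega
  have := hd.2 (p + u.length) (q + u.length)
    (by simpa using (isRun_add_period hper 1 p q).2 hd.1)
    (by simpa using typeAt_add_period hper 1 p) fun h => by
      have := Int.le_of_dvd (by omega) h
      omega
  omega

/-- The word-level conditions that unroll to a `CyclicWord`. -/
structure EvenReduced (w : List Letter) : Prop where
  two_le : 2 ≤ w.length
  even : 2 ∣ w.length
  reduced : Reduced (unroll w)

lemma EvenReduced.ne_nil {w : List Letter} (h : EvenReduced w) : w ≠ [] :=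
  List.ne_nil_of_length_pos (by have := h.two_le; omega)

/-- The cyclic word represented by a list of letters. -/
def EvenReduced.toCyclicWord {w : List Letter} (h : EvenReduced w) : CyclicWord where
  toFun := unroll w
  period := w.length
  two_le := by have := h.two_le; omega
  even := by have := h.even; omega
  periodic := unroll_periodic w
  reduced := h.reduced

lemma InG.evenReduced {w : List Letter} (h : InG w) : EvenReduced w :=
  ⟨by have := h.2.2.2; omega, h.2.2.1, (cyclRed_iff h.1.1).1 h.1⟩

lemma EvenReduced.wordEquiv_iff {u v : List Letter} (hu : EvenReduced u) (hv : EvenReduced v) :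
    WordEquiv u v ↔ hu.toCyclicWord.Equiv hv.toCyclicWord := by
  rw [_root_.wordEquiv_iff hu.ne_nil hu.even]
  exact and_congr_left fun _ => Nat.cast_inj.symm

lemma EvenReduced.inG {w : List Letter} (h : EvenReduced w) {p q : ℤ}
    (hd : Dominant 0 (unroll w) w.length p q) : InG w := by
  have h1 := hd.1.length_lt (by have := h.two_le; omega) (unroll_periodic w) h.reduced
  have h2 := hd.1.1
  have h3 := h.even
  exact ⟨(cyclRed_iff h.ne_nil).2 h.reduced, hd.primitive h.ne_nil, h3, by omega⟩

lemma EvenReduced.expandAt {w : List Letter} (h : EvenReduced w) {i : ℕ} (hi : i < w.length) :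
    EvenReduced (expandAt w i) := by
  have hp := unroll_periodic (_root_.expandAt w i)
  have h2 := h.two_le
  have he := h.even
  rw [length_expandAt] at hp
  exact ⟨by rw [length_expandAt]; omega, by rw [length_expandAt]; omega,
    (insertion_expandAt hi).reduced_right (by omega) (unroll_periodic w) hp h.reduced⟩

lemma EvenReduced.contracts_expandAt {w : List Letter} (h : EvenReduced w) {i len : ℕ}
    (hd : DistinguishedRun w i len) :
    (h.expandAt hd.1.1).toCyclicWord.Contracts h.toCyclicWord := by
  have hp := unroll_periodic (_root_.expandAt w i)
  have hl := length_expandAt w i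
  have hl' : ((_root_.expandAt w i).length : ℤ) = w.length + 2 := by omega
  rw [hl'] at hp
  exact ⟨hl', _, _, _, hd.dominant h.reduced h.two_le, insertion_expandAt hd.1.1, hp,
    dihedralEquiv_refl _⟩

lemma Desc.reduces {w u : List Letter} (hw : EvenReduced w) (h : Desc w u) :
    ∃ hu : EvenReduced u,
      Relation.ReflTransGen CyclicWord.Reduces hu.toCyclicWord hw.toCyclicWord := by
  induction h with
  | base => exact ⟨hw, .refl⟩
  | step v i len _ hd ih =>
    obtain ⟨hv, hr⟩ := ih
    exact ⟨hv.expandAt hd.1.1, .head (Or.inr (hv.contracts_expandAt hd)) hr⟩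

lemma gEquiv_equivalence : Equivalence GEquiv where
  refl u := (u.2.evenReduced.wordEquiv_iff u.2.evenReduced).2 ⟨rfl, dihedralEquiv_refl _⟩
  symm {u v} h := by
    have hu := u.2.evenReduced
    have hv := v.2.evenReduced
    rw [GEquiv, hu.wordEquiv_iff hv] at h
    exact (hv.wordEquiv_iff hu).2 h.symm
  trans {u v w} h h' := by
    have hu := u.2.evenReduced
    have hv := v.2.evenReduced
    have hw := w.2.evenReduced
    rw [GEquiv, hu.wordEquiv_iff hv] at h
    rw [GEquiv, hv.wordEquiv_iff hw] at h'
    exact (hu.wordEquiv_iff hw).2 (h.trans h')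

lemma gClass_mk_eq_iff (u v : GWord) :
    Quot.mk GEquiv u = Quot.mk GEquiv v ↔ WordEquiv u.1 v.1 :=
  ⟨fun h => gEquiv_equivalence.eqvGen_iff.1 (Quot.eqvGen_exact h), fun h => Quot.sound h⟩

lemma isMotif_toCyclicWord_iff {w : List Letter} (h : EvenReduced w) :
    h.toCyclicWord.IsMotif ↔ MotifCond w := (motifCond_iff h.reduced h.two_le).symm

/-- Every word of `𝒢` is equivalent to a descendant of a motif. -/
lemma exists_motif_desc (n : ℕ) : ∀ v : List Letter, v.length = n → InG v →
    ∃ w u, InG w ∧ InG u ∧ MotifCond w ∧ Desc w u ∧ WordEquiv u v := by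
  induction n using Nat.strong_induction_on with
  | _ n ih =>
    intro v hn hv
    have hve := hv.evenReduced
    by_cases hm : MotifCond v
    · exact ⟨v, v, hv, hv, hm, .base, (hve.wordEquiv_iff hve).2 ⟨rfl, dihedralEquiv_refl _⟩⟩
    rw [motifCond_iff hve.reduced hve.two_le] at hm
    push Not at hm
    obtain ⟨p, q, hd, hq⟩ := hm
    have h4 := hv.2.2.2
    have hev := hve.even
    obtain ⟨m, hml⟩ : ∃ m, v.length = m + 2 := ⟨v.length - 2, by omega⟩
    have hvp := unroll_periodic v
    have hml' : (v.length : ℤ) = m + 2 := by omega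
    rw [hml'] at hd hvp
    obtain ⟨f, hf, hi, hdf⟩ := Dominant.exists_insertion (c := 0) hd (by omega) hvp hq
    obtain ⟨v₀, rfl, rfl⟩ := exists_unroll_eq (by omega) hf
    have hv₀ : EvenReduced v₀ :=
      ⟨by omega, by omega, hi.reduced_left (by omega) hf hvp hve.reduced⟩
    obtain ⟨w, u₀, hw, hu₀, hwm, hwu, he⟩ := ih v₀.length (by omega) v₀ rfl (hv₀.inG hdf)
    have hue := hu₀.evenReduced
    obtain ⟨hl, he⟩ := (wordEquiv_iff hue.ne_nil hue.even).1 he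
    obtain ⟨g, p', q', hg, hig, hdg, heg⟩ :=
      hi.exists_of_dihedralEquiv_left (by omega) hf hvp hdf he.symm
    rw [← hl] at hg hig hdg
    obtain ⟨k, i, len, h1, -, hr, hdi⟩ := hdg.exists_runAt hue.reduced hue.two_le
    have hdist : DistinguishedRun u₀ i len := ⟨hr, fun i' len' h5 h6 h7 => by
      have := (dominant_iff hue.reduced hue.two_le hr).1 hdi i' len' h5 h6 h7
      omega⟩
    have hie := insertion_expandAt hr.1
    have hpe := unroll_periodic (expandAt u₀ i)
    have hle : ((expandAt u₀ i).length : ℤ) = u₀.length + 2 := by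
      rw [length_expandAt]
      push_cast
      rfl
    rw [hle] at hpe
    have his := hig.shift (-k * u₀.length)
    rw [comp_add_eq (unroll_periodic u₀),
      show p' - -k * (u₀.length : ℤ) = i by rw [← h1]; ring] at his
    have hge := his.unique_right hie (by have := hue.two_le; omega) (periodic_shift hg _) hpe
    have hue' := hue.expandAt hr.1
    have hlt : (i : ℤ) < i + len - 1 := hdi.1.1
    have hde := (hie.dominant_self (by have := hue.two_le; omega) (unroll_periodic u₀) hpe
      hlt).2 hdi
    rw [← hle] at hde
    refine ⟨w, _, hw, hue'.inG ⟨hde.1, fun a b h5 h6 h7 => ?_⟩, hwm,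
      .step u₀ i len hwu hdist, (hue'.wordEquiv_iff hve).2 ⟨?_, ?_⟩⟩
    · have := hde.2 a b h5 h6 h7
      omega
    · change ((expandAt u₀ i).length : ℤ) = v.length
      omega
    · refine DihedralEquiv.trans ?_ heg.symm
      change DihedralEquiv (unroll (expandAt u₀ i)) g
      rw [← hge]
      obtain ⟨l, hl2⟩ := hue.even
      refine DihedralEquiv.symm ⟨-k * l, Or.inl fun j => ?_⟩
      dsimp only
      rw [hl2]
      congr 1
      push_cast
      ring

theorem almost_simple_geodesics_stmt8 (v : GWord) :
    ∃! c : GClass, ∃ w : GWord, Quot.mk GEquiv w = c ∧ MotifCond w.1 ∧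
      ∃ u : GWord, Desc w.1 u.1 ∧ Quot.mk GEquiv u = Quot.mk GEquiv v := by
  obtain ⟨w, u, hw, hu, hm, hwu, he⟩ := exists_motif_desc _ v.1 rfl v.2
  refine ⟨Quot.mk GEquiv ⟨w, hw⟩, ⟨⟨w, hw⟩, rfl, hm, ⟨u, hu⟩, hwu,
    (gClass_mk_eq_iff _ _).2 he⟩, ?_⟩
  rintro _ ⟨w', rfl, hm', u', hwu', he'⟩
  have hw₁ := hw.evenReduced
  have hw₂ := w'.2.evenReduced
  obtain ⟨hu₁, hr₁⟩ := hwu.reduces hw₁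
  obtain ⟨hu₂, hr₂⟩ := hwu'.reduces hw₂
  rw [gClass_mk_eq_iff, hu₂.wordEquiv_iff v.2.evenReduced] at he'
  rw [hu₁.wordEquiv_iff v.2.evenReduced] at he
  refine (gClass_mk_eq_iff _ _).2 ((hw₂.wordEquiv_iff hw₁).2 ?_)
  exact CyclicWord.equiv_of_isMotif (.head (Or.inl he'.symm) hr₂) (.head (Or.inl he.symm) hr₁)
    ((isMotif_toCyclicWord_iff hw₂).2 hm') ((isMotif_toCyclicWord_iff hw₁).2 hm)
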